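/- arXiv:1405.3948 — 2 statements merged into one kernel-verified Lean document; each statement's English description precedes it below -/
import Mathlib

section
/- Theorem 3: Let S : ℝ → ℝ ∪ {±∞} be subadditive and let 𝔸 ⊆ ℝ be an additive subgroup such that (i) S restricted to 𝔸 is finite (real-valued) and additive; (ii) there exists a shift-symmetric analytic spanning set T ⊆ 𝔸 such that the restriction of S to T is locally bounded above (each point of T has a neighbourhood U with S bounded above on T ∩ U). Then S is linear: there exists c ∈ ℝ such that S(u) = cu for all u ∈ ℝ. -/
open Filter Topology

section Capacitability

open MeasureTheory Set

/-- An open set containing a product of initial segments of `ℕ` contains a cylinder over finitely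
many of them. -/
theorem exists_cylinder_subset_of_pi_Iic_subset {a : ℕ → ℕ} {O : Set (ℕ → ℕ)} (hO : IsOpen O)
    (h : {x : ℕ → ℕ | ∀ i, x i ≤ a i} ⊆ O) :
    ∃ n, {x : ℕ → ℕ | ∀ i < n, x i ≤ a i} ⊆ O := by
  by_contra! hcon
  simp only [Set.not_subset] at hcon
  choose x hx hxO using hcon
  have hcomp : IsCompact (Set.pi univ fun i => Iic (a i)) :=
    isCompact_univ_pi fun i => (Set.finite_Iic (a i)).isCompact
  obtain ⟨y, hy, φ, hφ, hlim⟩ := hcomp.tendsto_subseq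
    (x := fun n i => min (x n i) (a i)) fun n i _ => mem_Iic.2 (min_le_right (x n i) (a i))
  have hlim' : Tendsto (x ∘ φ) atTop (𝓝 y) := by
    rw [tendsto_pi_nhds] at hlim ⊢
    intro i
    refine (hlim i).congr' ?_
    filter_upwards [eventually_gt_atTop i] with n hn
    exact min_eq_left (hx _ i (hn.trans_le (hφ.id_le n)))
  obtain ⟨n, hn⟩ := (hlim'.eventually (hO.mem_nhds (h fun i => hy i trivial))).exists
  exact hxO _ hn

/-- Analytic sets are inner regular for compact sets. -/
theorem MeasureTheory.AnalyticSet.exists_isCompact_le_measure {α : Type*} [TopologicalSpace α]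
    [MeasurableSpace α] (μ : Measure α) [μ.OuterRegular] {s : Set α} (hs : AnalyticSet s)
    {r : ENNReal} (hr : r < μ s) : ∃ K ⊆ s, IsCompact K ∧ r ≤ μ K := by
  rw [AnalyticSet] at hs
  obtain rfl | ⟨f, hf, rfl⟩ := hs
  · simp at hr
  have step : ∀ E : {E : Set (ℕ → ℕ) // r < μ (f '' E)}, ∀ n : ℕ, ∃ k : ℕ,
      r < μ (f '' (E.1 ∩ {x | x n ≤ k})) := by
    intro E n
    have hmono : Monotone fun k : ℕ => f '' (E.1 ∩ {x | x n ≤ k}) := fun k l hkl =>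
      image_mono (inter_subset_inter_right _ fun x hx => le_trans hx hkl)
    have hE : f '' E.1 = ⋃ k : ℕ, f '' (E.1 ∩ {x | x n ≤ k}) := by
      rw [← image_iUnion, ← inter_iUnion]
      congr 1
      exact (inter_eq_left.2 fun x _ => mem_iUnion.2 ⟨x n, le_refl (x n)⟩).symm
    have h := E.2
    rw [hE, hmono.measure_iUnion] at h
    exact lt_iSup_iff.1 h
  choose k hk using step
  let E : ℕ → {E : Set (ℕ → ℕ) // r < μ (f '' E)} := fun n =>
    Nat.rec ⟨univ, by rwa [image_univ]⟩ (fun n E => ⟨E.1 ∩ {x | x n ≤ k E n}, hk E n⟩) n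
  let a : ℕ → ℕ := fun n => k (E n) n
  have hE : ∀ n, (E n).1 = {x | ∀ i < n, x i ≤ a i} := by
    intro n
    induction n with
    | zero => exact (eq_univ_of_forall fun x i hi => absurd hi i.not_lt_zero).symm
    | succ n ih =>
      change (E n).1 ∩ {x | x n ≤ a n} = _
      rw [ih]
      ext x
      simp only [Order.lt_add_one_iff, mem_inter_iff, mem_ofPred_eq]
      refine ⟨fun h i hi => ?_, fun h => ⟨fun i hi => h i hi.le, h n le_rfl⟩⟩
      obtain hi | rfl := hi.lt_or_eq
      exacts [h.1 i hi, h.2]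
  have hcomp : IsCompact {x : ℕ → ℕ | ∀ i, x i ≤ a i} := by
    convert isCompact_univ_pi fun i => (Set.finite_Iic (a i)).isCompact using 1
    ext x
    simp [Pi.le_def]
  refine ⟨_, image_subset_range f _, hcomp.image hf, ?_⟩
  rw [Set.measure_eq_iInf_isOpen]
  refine le_iInf₂ fun U hU => le_iInf fun hUo => ?_
  obtain ⟨n, hn⟩ := exists_cylinder_subset_of_pi_Iic_subset (hUo.preimage hf) (image_subset_iff.1 hU)
  have h := (E n).2
  rw [hE n] at h
  exact h.le.trans (measure_mono (image_subset_iff.2 hn))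

end Capacitability

section AnalyticArithmetic

open MeasureTheory Set Pointwise

theorem MeasureTheory.AnalyticSet.add {G : Type*} [TopologicalSpace G] [Add G] [ContinuousAdd G]
    {s t : Set G} (hs : AnalyticSet s) (ht : AnalyticSet t) : AnalyticSet (s + t) := by
  obtain ⟨β, _, _, f, hf, rfl⟩ := analyticSet_iff_exists_polishSpace_range.1 hs
  obtain ⟨γ, _, _, g, hg, rfl⟩ := analyticSet_iff_exists_polishSpace_range.1 ht
  convert analyticSet_range_of_polishSpace (f := fun p : β × γ => f p.1 + g p.2) (by fun_prop)
  ext x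
  simp [Set.mem_add]

theorem MeasureTheory.AnalyticSet.neg {G : Type*} [TopologicalSpace G] [InvolutiveNeg G]
    [ContinuousNeg G] {s : Set G} (hs : AnalyticSet s) : AnalyticSet (-s) := by
  rw [← Set.image_neg_eq_neg]
  exact hs.image_of_continuous continuous_neg

theorem MeasureTheory.AnalyticSet.nsmul {G : Type*} [TopologicalSpace G] [AddMonoid G]
    [ContinuousAdd G] [T1Space G] {s : Set G} (hs : AnalyticSet s) (n : ℕ) :
    AnalyticSet (n • s) := by
  induction n with
  | zero =>
    rw [zero_nsmul, ← Set.singleton_zero, ← Set.range_const (ι := Unit)]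
    exact analyticSet_range_of_polishSpace continuous_const
  | succ n ih =>
    rw [succ_nsmul]
    exact ih.add hs

/-- Every element of the `ℚ`-span has a positive integer multiple in the additive closure. -/
theorem exists_nsmul_mem_closure_of_mem_span {E : Type*} [AddCommGroup E] [Module ℚ E]
    {T : Set E} {x : E} (hx : x ∈ Submodule.span ℚ T) :
    ∃ m : ℕ, m ≠ 0 ∧ m • x ∈ AddSubgroup.closure T := by
  induction hx using Submodule.span_induction with
  | mem x h => exact ⟨1, one_ne_zero, by simpa using AddSubgroup.subset_closure h⟩
  | zero => exact ⟨1, one_ne_zero, by simp⟩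
  | add x y _ _ hx hy =>
    obtain ⟨m, hm, hx⟩ := hx
    obtain ⟨n, hn, hy⟩ := hy
    refine ⟨m * n, mul_ne_zero hm hn, ?_⟩
    rw [nsmul_add, mul_nsmul, mul_comm m n, mul_nsmul]
    exact add_mem (nsmul_mem hx n) (nsmul_mem hy m)
  | smul q x _ hx =>
    obtain ⟨m, hm, hx⟩ := hx
    refine ⟨q.den * m, mul_ne_zero q.den_ne_zero hm, ?_⟩
    have h : (q.den * m) • q • x = q.num • m • x := by
      rw [← Nat.cast_smul_eq_nsmul ℚ, ← Nat.cast_smul_eq_nsmul ℚ m, ← Int.cast_smul_eq_zsmul ℚ,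
        smul_smul, smul_smul]
      congr 1
      push_cast
      rw [mul_right_comm, Rat.den_mul_eq_num]
    rw [h]
    exact zsmul_mem hx _

/-- The union of finitely many members of a family of sets, made symmetric and to contain `0`. -/
def symmUnion {ι G : Type*} [Zero G] [Neg G] (V : ι → Set G) (F : Finset ι) : Set G :=
  {0} ∪ ⋃ i ∈ F, (V i ∪ -V i)

theorem mem_symmUnion {ι G : Type*} [Zero G] [Neg G] {V : ι → Set G} {F : Finset ι} {x : G} :
    x ∈ symmUnion V F ↔ x = 0 ∨ ∃ i ∈ F, x ∈ V i ∨ -x ∈ V i := by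
  simp [symmUnion]

theorem symmUnion_mono {ι G : Type*} [Zero G] [Neg G] {V : ι → Set G} {F H : Finset ι}
    (h : F ⊆ H) : symmUnion V F ⊆ symmUnion V H := fun x => by
  simp only [mem_symmUnion]
  exact Or.imp_right fun ⟨i, hi, hx⟩ => ⟨i, h hi, hx⟩

theorem neg_symmUnion {ι G : Type*} [AddGroup G] (V : ι → Set G) (F : Finset ι) :
    -symmUnion V F = symmUnion V F := by
  ext x
  simp [mem_symmUnion, or_comm]

theorem analyticSet_symmUnion {ι G : Type*} [TopologicalSpace G] [AddGroup G]
    [ContinuousNeg G] [Countable ι] {V : ι → Set G} (hV : ∀ i, AnalyticSet (V i))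
    (F : Finset ι) : AnalyticSet (symmUnion V F) := by
  have h0 : AnalyticSet ({0} : Set G) := by
    rw [← Set.range_const (ι := Unit)]
    exact analyticSet_range_of_polishSpace continuous_const
  have hU : ∀ {s t : Set G}, AnalyticSet s → AnalyticSet t → AnalyticSet (s ∪ t) := by
    intro s t hs ht
    rw [Set.union_eq_iUnion]
    exact .iUnion (Bool.rec ht hs)
  rw [symmUnion, ← Finset.set_biUnion_coe, biUnion_eq_iUnion]
  exact hU h0 (.iUnion fun i => hU (hV i) (hV i).neg)

theorem exists_mem_nsmul_symmUnion {ι G : Type*} [AddCommGroup G] {V : ι → Set G} {x : G}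
    (hx : x ∈ AddSubgroup.closure (⋃ i, V i)) : ∃ (F : Finset ι) (n : ℕ), x ∈ n • symmUnion V F := by
  classical
  induction hx using AddSubgroup.closure_induction with
  | mem x h =>
    obtain ⟨i, hi⟩ := mem_iUnion.1 h
    exact ⟨{i}, 1, by simp [mem_symmUnion, hi]⟩
  | zero => exact ⟨∅, 0, by simp⟩
  | add x y _ _ hx hy =>
    obtain ⟨F, m, hx⟩ := hx
    obtain ⟨H, n, hy⟩ := hy
    refine ⟨F ∪ H, m + n, ?_⟩
    rw [add_nsmul]
    exact add_mem_add (nsmul_subset_nsmul_left (symmUnion_mono Finset.subset_union_left) hx)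
      (nsmul_subset_nsmul_left (symmUnion_mono Finset.subset_union_right) hy)
  | neg x _ hx =>
    obtain ⟨F, n, hx⟩ := hx
    refine ⟨F, n, ?_⟩
    rw [← neg_symmUnion, neg_nsmul]
    exact neg_mem_neg.2 hx

/-- A countable union of analytic sets spanning `ℝ` over `ℚ` has finitely many members of which
some iterated sumset has nonzero measure. -/
theorem exists_volume_nsmul_symmUnion_ne_zero {ι : Type*} [Countable ι] {V : ι → Set ℝ}
    (hspan : Submodule.span ℚ (⋃ i, V i) = ⊤) :
    ∃ (F : Finset ι) (n : ℕ), volume (n • symmUnion V F) ≠ 0 := by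
  by_contra! hcon
  have hcov : (univ : Set ℝ) ⊆ ⋃ (m : ℕ) (F : Finset ι) (n : ℕ),
      ((m : ℝ)⁻¹) • (n • symmUnion V F) := by
    intro x _
    obtain ⟨m, hm, hx⟩ := exists_nsmul_mem_closure_of_mem_span (hspan ▸ Submodule.mem_top (x := x))
    obtain ⟨F, n, hx⟩ := exists_mem_nsmul_symmUnion hx
    simp only [mem_iUnion]
    refine ⟨m, F, n, m • x, hx, ?_⟩
    simp [hm]
  have h0 : volume (⋃ (m : ℕ) (F : Finset ι) (n : ℕ),
      ((m : ℝ)⁻¹) • (n • symmUnion V F)) = 0 := by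
    simp only [measure_iUnion_null_iff]
    intro m F n
    rw [Measure.addHaar_smul, hcon, mul_zero]
  simpa using measure_mono_null hcov h0

end AnalyticArithmetic

section AdditiveFunctions

open MeasureTheory Set Pointwise

/-- An additive function on `ℝ` which is bounded near `0` is linear. -/
theorem AddMonoidHom.eq_mul_of_eventually_abs_le {f : ℝ →+ ℝ} {M : ℝ}
    (hM : ∀ᶠ x in 𝓝 0, |f x| ≤ M) (x : ℝ) : f x = f 1 * x := by
  have hf : Continuous f := by
    refine continuous_of_continuousAt_zero f ?_
    rw [ContinuousAt, map_zero, Metric.tendsto_nhds]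
    intro ε hε
    obtain ⟨n, hn⟩ := exists_nat_gt (M / ε)
    have hlim : Tendsto (fun x : ℝ => (n + 1) • x) (𝓝 0) (𝓝 0) :=
      (continuous_const_smul (n + 1)).tendsto' 0 0 (by simp)
    filter_upwards [hlim.eventually hM] with x hx
    rw [map_nsmul, nsmul_eq_mul, abs_mul, Nat.abs_cast, Nat.cast_add_one] at hx
    rw [Real.dist_eq, sub_zero]
    rw [div_lt_iff₀ hε] at hn
    by_contra! h
    nlinarith [mul_le_mul_of_nonneg_left h (Nat.cast_nonneg (α := ℝ) n)]
  have h := (f.toRealLinearMap hf).map_smul x 1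
  simp only [smul_eq_mul, mul_one, AddMonoidHom.coe_toRealLinearMap] at h
  rw [h, mul_comm]

/-- A subgroup of `ℝ` containing countably many analytic sets which span `ℝ` over `ℚ` is the whole
line, and an additive function bounded on each of these sets is linear. -/
theorem AddSubgroup.eq_top_and_eq_mul_of_analyticSet_cover {ι : Type*} [Countable ι]
    {A : AddSubgroup ℝ} (f : A →+ ℝ) {V : ι → Set ℝ} (hV : ∀ i, AnalyticSet (V i))
    (hVA : ∀ i, V i ⊆ A) (hspan : Submodule.span ℚ (⋃ i, V i) = ⊤)
    (hbdd : ∀ i, ∃ M, ∀ a : A, (a : ℝ) ∈ V i → |f a| ≤ M) :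
    A = ⊤ ∧ ∃ c, ∀ a : A, f a = c * a := by
  obtain ⟨F, n, hpos⟩ := exists_volume_nsmul_symmUnion_ne_zero hspan
  have hWA : symmUnion V F ⊆ A := by
    intro x hx
    obtain rfl | ⟨i, _, hi | hi⟩ := mem_symmUnion.1 hx
    exacts [A.zero_mem, hVA i hi, neg_mem_iff.1 (hVA i hi)]
  have hWM : ∃ M, ∀ a : A, (a : ℝ) ∈ symmUnion V F → |f a| ≤ M := by
    choose M hM using hbdd
    refine ⟨∑ i ∈ F, |M i|, fun a ha => ?_⟩
    obtain h | ⟨i, hiF, hi⟩ := mem_symmUnion.1 ha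
    · obtain rfl : a = 0 := Subtype.ext h
      rw [map_zero, abs_zero]
      exact Finset.sum_nonneg fun i _ => abs_nonneg _
    · have hle : |f a| ≤ M i := by
        obtain hi | hi := hi
        · exact hM i a hi
        · simpa using hM i (-a) (by simpa using hi)
      exact (hle.trans (le_abs_self _)).trans
        (Finset.single_le_sum (f := fun i => |M i|) (fun i _ => abs_nonneg _) hiF)
  obtain ⟨M, hM⟩ := hWM
  have hnW : ∀ k : ℕ, ∀ x ∈ k • symmUnion V F, ∃ a : A, (a : ℝ) = x ∧ |f a| ≤ k * M := by
    intro k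
    induction k with
    | zero =>
      intro x hx
      refine ⟨0, ?_, by simp⟩
      simpa [eq_comm] using hx
    | succ k ih =>
      intro x hx
      rw [succ_nsmul] at hx
      obtain ⟨y, hy, z, hz, rfl⟩ := hx
      obtain ⟨a, rfl, ha⟩ := ih y hy
      refine ⟨a + ⟨z, hWA hz⟩, rfl, ?_⟩
      rw [map_add]
      push_cast
      linarith [abs_add_le (f a) (f ⟨z, hWA hz⟩), hM ⟨z, hWA hz⟩ hz]
  obtain ⟨r, hr0, hr⟩ := exists_between (pos_iff_ne_zero.2 hpos)
  obtain ⟨K, hKs, hK, hrK⟩ :=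
    ((analyticSet_symmUnion hV F).nsmul n).exists_isCompact_le_measure volume hr
  have hnhds : K - K ∈ 𝓝 (0 : ℝ) :=
    Measure.sub_mem_nhds_zero_of_addHaar_pos volume K hK.measurableSet (hr0.trans_le hrK)
  have hKK : ∀ x ∈ K - K, ∃ a : A, (a : ℝ) = x ∧ |f a| ≤ n * M + n * M := by
    rintro _ ⟨y, hy, z, hz, rfl⟩
    obtain ⟨a, rfl, ha⟩ := hnW n y (hKs hy)
    obtain ⟨b, rfl, hb⟩ := hnW n z (hKs hz)
    refine ⟨a - b, rfl, ?_⟩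
    rw [map_sub]
    exact (abs_sub _ _).trans (add_le_add ha hb)
  have hAtop : A = ⊤ := by
    have hAn : (A : Set ℝ) ∈ 𝓝 0 := by
      filter_upwards [hnhds] with x hx
      obtain ⟨a, rfl, -⟩ := hKK x hx
      exact a.2
    have hAo : IsOpen (A : Set ℝ) := A.isOpen_of_mem_nhds hAn
    exact SetLike.coe_injective
      (IsClopen.eq_univ ⟨A.isClosed_of_isOpen hAo, hAo⟩ ⟨0, A.zero_mem⟩)
  subst hAtop
  let g : ℝ →+ ℝ := f.comp (AddSubgroup.topEquiv (G := ℝ)).symm.toAddMonoidHom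
  refine ⟨rfl, g 1, fun a => AddMonoidHom.eq_mul_of_eventually_abs_le (f := g)
    (M := n * M + n * M) ?_ a⟩
  filter_upwards [hnhds] with x hx
  obtain ⟨a, rfl, ha⟩ := hKK x hx
  exact ha

/-- An additive function locally bounded above on a shift-symmetric set is locally bounded on
it. -/
theorem AddSubgroup.exists_abs_le_of_shift_symm {A : AddSubgroup ℝ} (f : A →+ ℝ) {T : Set ℝ}
    (hTA : T ⊆ A) {σ : ℝ} (hσ : ∀ t ∈ T, σ - t ∈ T)
    (hlb : ∀ t ∈ T, ∃ U ∈ 𝓝 t, ∃ M, ∀ a : A, (a : ℝ) ∈ T ∩ U → f a ≤ M) {t : ℝ} (ht : t ∈ T) :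
    ∃ U ∈ 𝓝 t, IsOpen U ∧ ∃ M, ∀ a : A, (a : ℝ) ∈ T ∩ U → |f a| ≤ M := by
  have hσA : σ ∈ A := by simpa using add_mem (hTA (hσ t ht)) (hTA ht)
  obtain ⟨U, hU, M, hM⟩ := hlb t ht
  obtain ⟨U', hU', M', hM'⟩ := hlb (σ - t) (hσ t ht)
  have hrefl : (fun x => σ - x) ⁻¹' U' ∈ 𝓝 t :=
    (continuous_const.sub continuous_id).continuousAt.preimage_mem_nhds hU'
  obtain ⟨O, hO, hOo, htO⟩ := mem_nhds_iff.1 (inter_mem hU hrefl)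
  refine ⟨O, hOo.mem_nhds htO, hOo, max M (M' - f ⟨σ, hσA⟩), fun a ha => ?_⟩
  have h1 := hM a ⟨ha.1, (hO ha.2).1⟩
  have h2 := hM' (⟨σ, hσA⟩ - a) ⟨hσ a ha.1, show σ - (a : ℝ) ∈ U' from (hO ha.2).2⟩
  rw [map_sub] at h2
  rw [abs_le]
  constructor
  · linarith [le_max_right M (M' - f ⟨σ, hσA⟩)]
  · exact h1.trans (le_max_left _ _)

end AdditiveFunctions

/-- Theorem 3: a subadditive extended-real-valued `S`, finite and additive on an additive
subgroup `A` containing a shift-symmetric analytic spanning set `T` on which `S` is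
locally bounded above, is linear. -/
theorem theorem3 (S : ℝ → EReal) (A : AddSubgroup ℝ) (T : Set ℝ)
    (hsub : ∀ u v : ℝ, S (u + v) ≤ S u + S v)
    (hfin : ∀ a ∈ A, ∃ r : ℝ, S a = (r : EReal))
    (hadd : ∀ a ∈ A, ∀ b ∈ A, S (a + b) = S a + S b)
    (hTA : T ⊆ (A : Set ℝ))
    (hshiftsym : ∃ τ : ℝ, -((fun x => x + τ) '' T) = (fun x => x + τ) '' T)
    (hanal : MeasureTheory.AnalyticSet T)
    (hspan : Submodule.span ℚ T = ⊤)
    (hlb : ∀ t ∈ T, ∃ U ∈ 𝓝 t, ∃ M : ℝ, ∀ x ∈ T ∩ U, S x ≤ ((M : ℝ) : EReal)) :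
    ∃ c : ℝ, ∀ u : ℝ, S u = ((c * u : ℝ) : EReal) := by
  choose g hg using fun a : A => hfin a a.2
  let f : A →+ ℝ := AddMonoidHom.mk' g fun a b => by
    have h := hadd a a.2 b b.2
    rw [hg a, hg b, ← AddSubgroup.coe_add, hg (a + b)] at h
    exact_mod_cast h
  obtain ⟨τ, hτ⟩ := hshiftsym
  have hσ : ∀ t ∈ T, -(2 * τ) - t ∈ T := by
    intro t ht
    have h : -(t + τ) ∈ -((fun x => x + τ) '' T) := Set.neg_mem_neg.2 ⟨t, ht, rfl⟩
    rw [hτ] at h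
    obtain ⟨s, hs, hst⟩ := h
    convert hs using 1
    linear_combination -hst
  have hlb' : ∀ t ∈ T, ∃ U ∈ 𝓝 t, ∃ M, ∀ a : A, (a : ℝ) ∈ T ∩ U → f a ≤ M := by
    intro t ht
    obtain ⟨U, hU, M, hM⟩ := hlb t ht
    refine ⟨U, hU, M, fun a ha => ?_⟩
    have h := hM a ha
    rw [hg a] at h
    exact_mod_cast h
  have hloc : ∀ t : T, ∃ U ∈ 𝓝 (t : ℝ), IsOpen U ∧
      ∃ M, ∀ a : A, (a : ℝ) ∈ T ∩ U → |f a| ≤ M :=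
    fun t => AddSubgroup.exists_abs_le_of_shift_symm f hTA hσ hlb' t.2
  choose U hU hUo hM using hloc
  obtain ⟨I, hI, hcov⟩ := TopologicalSpace.countable_cover_nhds
    fun t : T => continuous_subtype_val.continuousAt.preimage_mem_nhds (hU t)
  have : Countable I := hI.to_subtype
  have hTeq : ⋃ t : I, T ∩ U t = T := by
    refine subset_antisymm (Set.iUnion_subset fun t => Set.inter_subset_left) fun x hx => ?_
    obtain ⟨t, ht, hxt⟩ := Set.mem_iUnion₂.1 (hcov ▸ Set.mem_univ (⟨x, hx⟩ : T))
    exact Set.mem_iUnion.2 ⟨⟨t, ht⟩, hx, hxt⟩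
  obtain ⟨rfl, c, hc⟩ := AddSubgroup.eq_top_and_eq_mul_of_analyticSet_cover f
    (V := fun t : I => T ∩ U t)
    (fun t => by
      rw [Set.inter_eq_iInter]
      exact .iInter (Bool.rec (hUo t).measurableSet.analyticSet hanal))
    (fun t => Set.inter_subset_left.trans hTA) (hTeq.symm ▸ hspan) (fun t => hM t)
  refine ⟨c, fun u => ?_⟩
  rw [← hc ⟨u, AddSubgroup.mem_top u⟩]
  exact hg ⟨u, AddSubgroup.mem_top u⟩
end

section
/- Theorem 4 (Automatic right-continuity, after Jones–Kominek): Let S : ℝ → ℝ be subadditive with S(0) = 0, let T ⊆ (−1,1) be a symmetric analytic spanning set with S restricted to T locally bounded above, and suppose the condition JK(T)_0 holds: limsup_{n→∞} sup{S(x) : x ∈ T/n} ≤ 0, where T/n := {t/n : t ∈ T}. Then S(0+) = 0, i.e. S(v) → 0 as v → 0 through positive values. -/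
open Filter Topology

/-- The set of sums of `m` elements of `T`. -/
def sumset (T : Set ℝ) : ℕ → Set ℝ
  | 0 => {0}
  | m + 1 => (fun p : ℝ × ℝ => p.1 + p.2) '' (T ×ˢ sumset T m)

section Sumset

variable {T : Set ℝ}

theorem add_mem_sumset_succ {m : ℕ} {t x : ℝ} (ht : t ∈ T) (hx : x ∈ sumset T m) :
    t + x ∈ sumset T (m + 1) :=
  ⟨(t, x), ⟨ht, hx⟩, rfl⟩

theorem add_mem_sumset {m n : ℕ} {x y : ℝ} (hx : x ∈ sumset T m) (hy : y ∈ sumset T n) :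
    x + y ∈ sumset T (m + n) := by
  induction m generalizing x with
  | zero =>
    obtain rfl : x = 0 := hx
    simpa using hy
  | succ m ih =>
    obtain ⟨⟨t, z⟩, ⟨ht, hz⟩, rfl⟩ := hx
    have h := add_mem_sumset_succ ht (ih hz)
    rw [← add_assoc] at h
    rwa [Nat.add_right_comm]

theorem nat_mul_mem_sumset {m : ℕ} {x : ℝ} (hx : x ∈ sumset T m) (k : ℕ) :
    k * x ∈ sumset T (k * m) := by
  induction k with
  | zero => simp [sumset]
  | succ k ih =>
    have h := add_mem_sumset ih hx
    rw [Nat.succ_mul]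
    convert h using 1
    push_cast
    ring

theorem neg_mem_sumset (hsym : -T = T) {m : ℕ} {x : ℝ} (hx : x ∈ sumset T m) :
    -x ∈ sumset T m := by
  induction m generalizing x with
  | zero =>
    obtain rfl : x = 0 := hx
    simp [sumset]
  | succ m ih =>
    obtain ⟨⟨t, z⟩, ⟨ht, hz⟩, rfl⟩ := hx
    have ht' : -t ∈ T := by
      rw [← hsym]
      simpa using ht
    have h := add_mem_sumset_succ ht' (ih hz)
    rwa [← neg_add] at h

theorem MeasureTheory.AnalyticSet.sumset (hT : MeasureTheory.AnalyticSet T) (m : ℕ) :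
    MeasureTheory.AnalyticSet (sumset T m) := by
  induction m with
  | zero => exact (MeasurableSet.singleton (0 : ℝ)).analyticSet
  | succ m ih =>
    refine MeasureTheory.AnalyticSet.image_of_continuous ?_ (by fun_prop)
    rw [Set.prod_eq, Set.inter_eq_iInter]
    refine MeasureTheory.AnalyticSet.iInter fun b => ?_
    cases b
    · exact ih.preimage continuous_snd
    · exact hT.preimage continuous_fst

theorem exists_nat_mul_mem_sumset (hsym : -T = T) {x : ℝ} (hx : x ∈ Submodule.span ℚ T) :
    ∃ m q : ℕ, ((q : ℝ) + 1) * x ∈ sumset T m := by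
  suffices h : ∃ m q : ℕ, 0 < q ∧ (q : ℝ) * x ∈ sumset T m by
    obtain ⟨m, q, hq, h⟩ := h
    obtain ⟨q, rfl⟩ := Nat.exists_eq_succ_of_ne_zero hq.ne'
    exact ⟨m, q, by simpa using h⟩
  induction hx using Submodule.span_induction with
  | mem x hx =>
    exact ⟨1, 1, one_pos, by
      simpa using add_mem_sumset_succ hx (show (0 : ℝ) ∈ sumset T 0 from rfl)⟩
  | zero => exact ⟨0, 1, one_pos, by simp [sumset]⟩
  | add x y _ _ hx hy =>
    obtain ⟨m, q, hq, hx⟩ := hx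
    obtain ⟨n, r, hr, hy⟩ := hy
    refine ⟨r * m + q * n, r * q, Nat.mul_pos hr hq, ?_⟩
    convert add_mem_sumset (nat_mul_mem_sumset hx r) (nat_mul_mem_sumset hy q) using 1
    push_cast
    ring
  | smul a x _ hx =>
    obtain ⟨m, q, hq, hx⟩ := hx
    have hden : (a.den : ℝ) ≠ 0 := by exact_mod_cast a.den_ne_zero
    have key : ((a.den * q : ℕ) : ℝ) * (a • x) = (a.num : ℝ) * (q * x) := by
      rw [Rat.smul_def, Rat.cast_def]
      push_cast
      field_simp
    refine ⟨a.num.natAbs * m, a.den * q, Nat.mul_pos a.den_pos hq, ?_⟩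
    rw [key]
    have h := nat_mul_mem_sumset hx a.num.natAbs
    have hcast : ((a.num.natAbs : ℕ) : ℝ) = |(a.num : ℝ)| := by
      rw [Nat.cast_natAbs, Int.cast_abs]
    rw [hcast] at h
    rcases abs_cases (a.num : ℝ) with ⟨h', _⟩ | ⟨h', _⟩
    · rwa [h'] at h
    · rw [h'] at h
      simpa using neg_mem_sumset hsym h

theorem apply_div_le_of_mem_sumset {S : ℝ → ℝ} (hsub : ∀ u v : ℝ, S (u + v) ≤ S u + S v)
    (h0 : S 0 = 0) {c ε : ℝ} (hS : ∀ t ∈ T, S (t / c) ≤ ε) {m : ℕ} {x : ℝ}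
    (hx : x ∈ sumset T m) : S (x / c) ≤ m * ε := by
  induction m generalizing x with
  | zero =>
    obtain rfl : x = 0 := hx
    simp [h0]
  | succ m ih =>
    obtain ⟨⟨t, z⟩, ⟨ht, hz⟩, rfl⟩ := hx
    have h := hsub (t / c) (z / c)
    rw [← add_div] at h
    have h1 := hS t ht
    have h2 := ih hz
    push_cast
    simp only at *
    linarith

end Sumset

open MeasureTheory in
/-- Capacitability: the range of a continuous function on the Baire space is inner regular with
respect to compact sets. -/
theorem exists_isCompact_subset_range_le_measure {X : Type*} [TopologicalSpace X]
    [MeasurableSpace X] (μ : Measure X) [μ.OuterRegular] {f : (ℕ → ℕ) → X} (hf : Continuous f)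
    {c : ENNReal} (hc : c < μ (Set.range f)) :
    ∃ K ⊆ Set.range f, IsCompact K ∧ c ≤ μ K := by
  have step : ∀ (n : ℕ) (A : {A : Set (ℕ → ℕ) // c < μ (f '' A)}),
      ∃ j : ℕ, c < μ (f '' (A.1 ∩ {x | x n ≤ j})) := by
    rintro n ⟨A, hA⟩
    have hU : f '' A = ⋃ j : ℕ, f '' (A ∩ {x | x n ≤ j}) := by
      rw [← Set.image_iUnion, ← Set.inter_iUnion]
      congr 1
      refine (Set.inter_eq_left.2 fun x _ => Set.mem_iUnion.2 ⟨x n, le_refl (x n)⟩).symm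
    have hmono : Monotone fun j : ℕ => f '' (A ∩ {x | x n ≤ j}) := fun i j hij =>
      Set.image_mono (Set.inter_subset_inter_right _ fun x (hx : x n ≤ i) => hx.trans hij)
    rw [hU, hmono.measure_iUnion] at hA
    exact lt_iSup_iff.1 hA
  choose j hj using step
  let A : ℕ → {A : Set (ℕ → ℕ) // c < μ (f '' A)} := fun n =>
    Nat.rec ⟨Set.univ, by rwa [Set.image_univ]⟩ (fun n A => ⟨_, hj n A⟩) n
  let k : ℕ → ℕ := fun n => j n (A n)
  have hA : ∀ n, ∀ x ∈ (A n).1, ∀ i < n, x i ≤ k i := by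
    intro n
    induction n with
    | zero => intro x _ i hi; exact absurd hi (Nat.not_lt_zero i)
    | succ n ih =>
      intro x hx i hi
      have hx' : x ∈ (A n).1 ∩ {x | x n ≤ k n} := hx
      rcases Nat.lt_succ_iff_lt_or_eq.1 hi with h | rfl
      · exact ih x hx'.1 i h
      · exact hx'.2
  have hK : IsCompact (Set.univ.pi fun i => Set.Iic (k i)) :=
    isCompact_univ_pi fun i => (Set.finite_Iic (k i)).isCompact
  refine ⟨f '' Set.univ.pi fun i => Set.Iic (k i), Set.image_subset_range _ _, hK.image hf, ?_⟩
  by_contra! hlt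
  obtain ⟨U, hKU, hU, hμU⟩ := Set.exists_isOpen_lt_of_lt _ c hlt
  have hnot : ∀ n, ∃ x ∈ (A n).1, f x ∉ U := by
    intro n
    by_contra! h
    exact ((A n).2.trans_le (measure_mono (Set.image_subset_iff.2 h))).not_gt hμU
  choose x hxA hxU using hnot
  obtain ⟨y, hy, φ, hφ, hlim⟩ := hK.tendsto_subseq (x := fun n i => min (x n i) (k i))
    fun n i _ => Set.mem_Iic.2 (min_le_right (x n i) (k i))
  have hlim' : Tendsto (x ∘ φ) atTop (𝓝 y) := by
    rw [tendsto_pi_nhds] at hlim ⊢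
    intro i
    refine (hlim i).congr' ?_
    filter_upwards [eventually_gt_atTop i] with n hn
    exact min_eq_left (hA _ _ (hxA (φ n)) i (hn.trans_le hφ.le_apply))
  have hyU : U ∈ 𝓝 (f y) := hU.mem_nhds (hKU ⟨y, hy, rfl⟩)
  obtain ⟨n, hn⟩ := (((hf.tendsto y).comp hlim').eventually hyU).exists
  exact hxU _ hn

open MeasureTheory in
theorem exists_sumset_mem_nhds_zero {T : Set ℝ} (hsym : -T = T) (hanal : AnalyticSet T)
    (hspan : Submodule.span ℚ T = ⊤) : ∃ m, sumset T m ∈ 𝓝 (0 : ℝ) := by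
  obtain ⟨m, hm⟩ : ∃ m, volume (sumset T m) ≠ 0 := by
    by_contra! hnull
    have hcover : (Set.univ : Set ℝ) =
        ⋃ p : ℕ × ℕ, (fun x => ((p.2 : ℝ) + 1) • x) ⁻¹' sumset T p.1 := by
      refine (Set.eq_univ_of_forall fun x => ?_).symm
      obtain ⟨m, q, h⟩ := exists_nat_mul_mem_sumset hsym
        (show x ∈ Submodule.span ℚ T from hspan ▸ Submodule.mem_top)
      exact Set.mem_iUnion.2 ⟨(m, q), h⟩
    have hzero : volume (Set.univ : Set ℝ) = 0 := by
      rw [hcover, measure_iUnion_null_iff]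
      intro p
      rw [Measure.addHaar_preimage_smul _ (by positivity), hnull, mul_zero]
    simp at hzero
  have h := hanal.sumset m
  rw [AnalyticSet] at h
  rcases h with h | ⟨f, hf, hrange⟩
  · simp [h] at hm
  obtain ⟨c, hc0, hc⟩ := exists_between (pos_iff_ne_zero.2 hm)
  rw [← hrange] at hc
  obtain ⟨K, hKf, hK, hμK⟩ := exists_isCompact_subset_range_le_measure volume hf hc
  refine ⟨m + m, mem_of_superset
    (Measure.sub_mem_nhds_zero_of_addHaar_pos volume K hK.measurableSet (hc0.trans_le hμK)) ?_⟩
  rintro _ ⟨x, hx, y, hy, rfl⟩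
  rw [hrange] at hKf
  simpa [sub_eq_add_neg] using add_mem_sumset (hKf hx) (neg_mem_sumset hsym (hKf hy))

/-- Theorem 4 (Automatic right-continuity, after Jones–Kominek): a subadditive `S` with
`S(0) = 0`, locally bounded above on a symmetric analytic spanning set `T ⊆ (−1,1)`
satisfying `JK(T)₀`, has `S(0+) = 0`. -/
theorem theorem4 (S : ℝ → ℝ) (T : Set ℝ)
    (hsub : ∀ u v : ℝ, S (u + v) ≤ S u + S v)
    (h0 : S 0 = 0)
    (hT1 : T ⊆ Set.Ioo (-1 : ℝ) 1)
    (hsym : -T = T)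
    (hanal : MeasureTheory.AnalyticSet T)
    (hspan : Submodule.span ℚ T = ⊤)
    (hlb : ∀ t ∈ T, ∃ U ∈ 𝓝 t, ∃ M : ℝ, ∀ x ∈ T ∩ U, S x ≤ M)
    (hJK : limsup (fun n : ℕ =>
        sSup ((fun x => (S x : EReal)) '' ((fun t => t / ((n : ℝ) + 1)) '' T))) atTop ≤ 0) :
    Tendsto S (𝓝[>] (0 : ℝ)) (𝓝 0) := by
  obtain ⟨m, hm⟩ := exists_sumset_mem_nhds_zero hsym hanal hspan
  have upper : ∀ δ > 0, ∀ᶠ v in 𝓝 (0 : ℝ), S v < δ := by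
    intro δ hδ
    set ε : ℝ := δ / (m + 1) with hε
    have hε0 : 0 < ε := by positivity
    have hmε : m * ε < δ := by
      have : (m + 1) * ε = δ := by rw [hε]; field_simp
      linarith
    obtain ⟨n, hn⟩ := (eventually_lt_of_limsup_lt
      (hJK.trans_lt (EReal.coe_pos.2 hε0))).exists
    have hS : ∀ t ∈ T, S (t / ((n : ℝ) + 1)) ≤ ε := fun t ht =>
      EReal.coe_le_coe_iff.1
        ((le_sSup (Set.mem_image_of_mem _ (Set.mem_image_of_mem _ ht))).trans hn.le)
    have hn0 : (n : ℝ) + 1 ≠ 0 := by positivity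
    have hcont : Tendsto (fun v : ℝ => v * ((n : ℝ) + 1)) (𝓝 0) (𝓝 0) :=
      Continuous.tendsto' (by fun_prop) 0 0 (zero_mul _)
    filter_upwards [hcont hm] with v hv
    have h := apply_div_le_of_mem_sumset hsub h0 hS hv
    rw [mul_div_cancel_right₀ _ hn0] at h
    exact h.trans_lt hmε
  refine Tendsto.mono_left ?_ nhdsWithin_le_nhds
  rw [Metric.tendsto_nhds]
  intro δ hδ
  have hneg : Tendsto (fun v : ℝ => -v) (𝓝 0) (𝓝 0) :=
    Continuous.tendsto' (by fun_prop) 0 0 neg_zero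
  filter_upwards [upper δ hδ, hneg.eventually (upper δ hδ)] with v hv hv'
  have h := hsub v (-v)
  rw [add_neg_cancel, h0] at h
  rw [Real.dist_eq, sub_zero, abs_lt]
  constructor <;> linarith
end
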